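/- Fix an integer d ≥ 3 and a non-integer real ν > 0, and let φ_ν(t) = (1−t²)^ν for t ∈ [−1,1]. Then: (i) μ_k(φ_ν) = 0 for every odd k; (ii) for every even k ≥ 0, μ_k(φ_ν) = (ω_{d−2}/ω_{d−1}) · 2^{2ν+d−2} · (Γ(ν+(d−1)/2)² / Γ(2ν+d−1)) · Γ(1/2) Γ(ν+d/2) Γ((d−1)/2) Γ(ν+1) / ( Γ((1−k)/2) Γ((d+k−1)/2) Γ(ν+k/2+d/2) Γ(ν+1−k/2) ); (iii) there exists a nonzero constant C(d,ν) such that μ_k(φ_ν) ∼ C(d,ν) · k^{−d−2ν+1} as k → ∞ along even k, i.e., μ_k(φ_ν) · k^{d+2ν−1} → C(d,ν) as k → ∞ restricted to even k. -/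

import Mathlib

open Filter Asymptotics Real Set Topology

/-- Legendre polynomial of degree `k` in dimension `d` (Rodrigues formula). -/
noncomputable def legendreP (d k : ℕ) (t : ℝ) : ℝ :=
  (-1 / 2 : ℝ) ^ k * (Real.Gamma (((d : ℝ) - 1) / 2) / Real.Gamma ((k : ℝ) + ((d : ℝ) - 1) / 2)) *
    (1 - t ^ 2) ^ ((3 - (d : ℝ)) / 2) *
    iteratedDeriv k (fun s : ℝ => (1 - s ^ 2) ^ ((k : ℝ) + ((d : ℝ) - 3) / 2)) t

/-- Surface area `ω_{p-1}` of the unit sphere in `ℝ^p`. -/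
noncomputable def sphereSurface (p : ℕ) : ℝ :=
  2 * Real.pi ^ ((p : ℝ) / 2) / Real.Gamma ((p : ℝ) / 2)

/-- `μ_k(κ)`, the `k`-th Legendre coefficient of `κ` in dimension `d`. -/
noncomputable def legendreCoeff (d k : ℕ) (κ : ℝ → ℝ) : ℝ :=
  (sphereSurface (d - 1) / sphereSurface d) *
    ∫ t in (-1 : ℝ)..1, κ t * legendreP d k t * (1 - t ^ 2) ^ (((d : ℝ) - 3) / 2)

/-- Polynomial factor of the `j`-th derivative of `(1-t²)^c`. -/
noncomputable def rodQ : ℕ → ℝ → Polynomial ℝ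
  | 0, _ => 1
  | (j+1), c => (1 - Polynomial.X ^ 2) * Polynomial.derivative (rodQ j c) -
      Polynomial.C (2 * (c - j)) * Polynomial.X * rodQ j c

/-- Weighted integral of a polynomial. -/
noncomputable def wInt (e : ℝ) (P : Polynomial ℝ) : ℝ :=
  ∫ t in (-1 : ℝ)..1, (1 - t ^ 2) ^ e * P.eval t

lemma w_pos {t : ℝ} (ht : t ∈ Ioo (-1 : ℝ) 1) : 0 < 1 - t ^ 2 := by
  nlinarith [ht.1, ht.2]

lemma integral_congr_open {f g : ℝ → ℝ} (h : ∀ t ∈ Ioo (-1 : ℝ) 1, f t = g t) :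
    ∫ t in (-1 : ℝ)..1, f t = ∫ t in (-1 : ℝ)..1, g t := by
  rw [intervalIntegral.integral_of_le (by norm_num), intervalIntegral.integral_of_le (by norm_num),
    MeasureTheory.integral_Ioc_eq_integral_Ioo, MeasureTheory.integral_Ioc_eq_integral_Ioo]
  exact MeasureTheory.setIntegral_congr_fun measurableSet_Ioo h

lemma hasDerivAt_wP (p : ℝ) (P : Polynomial ℝ) {t : ℝ} (ht : t ∈ Ioo (-1 : ℝ) 1) :
    HasDerivAt (fun s : ℝ => (1 - s ^ 2) ^ p * P.eval s)
      ((1 - t ^ 2) ^ (p - 1) * ((1 - t ^ 2) * (Polynomial.derivative P).eval t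
        - 2 * p * t * P.eval t)) t := by
  have hw := w_pos ht
  have h1 : HasDerivAt (fun s : ℝ => 1 - s ^ 2) (-(2 * t)) t := by
    simpa using (hasDerivAt_pow 2 t).const_sub 1
  have h2 := (h1.rpow_const (p := p) (Or.inl hw.ne')).mul (P.hasDerivAt t)
  refine h2.congr_deriv ?_
  have : (1 - t ^ 2) ^ p = (1 - t ^ 2) ^ (p - 1) * (1 - t ^ 2) := by
    rw [Real.rpow_sub_one hw.ne']; field_simp
  rw [this]; ring

lemma iteratedDeriv_w (c : ℝ) (k : ℕ) : ∀ t ∈ Ioo (-1 : ℝ) 1,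
    iteratedDeriv k (fun s : ℝ => (1 - s ^ 2) ^ c) t = (1 - t ^ 2) ^ (c - k) * (rodQ k c).eval t := by
  induction k with
  | zero => intro t _; simp [rodQ]
  | succ k ih =>
    intro t ht
    rw [iteratedDeriv_succ]
    have : iteratedDeriv k (fun s : ℝ => (1 - s ^ 2) ^ c) =ᶠ[𝓝 t]
        fun s => (1 - s ^ 2) ^ (c - k) * (rodQ k c).eval s := by
      filter_upwards [isOpen_Ioo.mem_nhds ht] with s hs using ih s hs
    rw [this.deriv_eq, (hasDerivAt_wP (c - k) (rodQ k c) ht).deriv]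
    have e : c - ((k + 1 : ℕ) : ℝ) = c - k - 1 := by push_cast; ring
    rw [e]
    simp [rodQ]

lemma beta_real_integrable {e : ℝ} (he : -1 < e) :
    IntervalIntegrable (fun x : ℝ => x ^ e * (1 - x) ^ e) MeasureTheory.volume 0 1 := by
  have h := (Complex.betaIntegral_convergent (u := ((e + 1 : ℝ) : ℂ)) (v := ((e + 1 : ℝ) : ℂ))
    (by simp; linarith) (by simp; linarith)).norm
  refine h.congr_ae ?_
  rw [uIoc_of_le zero_le_one]
  filter_upwards [MeasureTheory.ae_restrict_mem measurableSet_Ioc] with x hx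
  have h1 : (((e + 1 : ℝ) : ℂ) - 1) = ((e : ℝ) : ℂ) := by push_cast; ring
  have h2 : (1 - (x : ℂ)) = ((1 - x : ℝ) : ℂ) := by push_cast; ring
  have hx1 : 0 ≤ 1 - x := by linarith [hx.2]
  rw [h1, h2, ← Complex.ofReal_cpow hx.1.le, ← Complex.ofReal_cpow hx1, ← Complex.ofReal_mul,
    Complex.norm_real, Real.norm_of_nonneg]
  exact mul_nonneg (Real.rpow_nonneg hx.1.le _) (Real.rpow_nonneg hx1 _)

lemma beta_real_value {e : ℝ} (he : -1 < e) :
    ∫ x in (0 : ℝ)..1, x ^ e * (1 - x) ^ e = Real.Gamma (e + 1) ^ 2 / Real.Gamma (2 * e + 2) := by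
  have h := Complex.betaIntegral_eq_Gamma_mul_div ((e + 1 : ℝ) : ℂ) ((e + 1 : ℝ) : ℂ)
    (by simp; linarith) (by simp; linarith)
  have h3 : Complex.betaIntegral ((e + 1 : ℝ) : ℂ) ((e + 1 : ℝ) : ℂ) =
      ((∫ x in (0 : ℝ)..1, x ^ e * (1 - x) ^ e : ℝ) : ℂ) := by
    rw [Complex.betaIntegral, ← intervalIntegral.integral_ofReal]
    refine intervalIntegral.integral_congr fun x hx => ?_
    rw [uIcc_of_le zero_le_one] at hx
    have h1 : (((e + 1 : ℝ) : ℂ) - 1) = ((e : ℝ) : ℂ) := by push_cast; ring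
    have h2 : (1 - (x : ℂ)) = ((1 - x : ℝ) : ℂ) := by push_cast; ring
    have hx1 : 0 ≤ 1 - x := by linarith [hx.2]
    rw [h1, h2, ← Complex.ofReal_cpow hx.1, ← Complex.ofReal_cpow hx1, ← Complex.ofReal_mul]
  rw [h3, ← Complex.ofReal_add, Complex.Gamma_ofReal, Complex.Gamma_ofReal] at h
  have h4 : (∫ x in (0 : ℝ)..1, x ^ e * (1 - x) ^ e) =
    Real.Gamma (e + 1) * Real.Gamma (e + 1) / Real.Gamma (e + 1 + (e + 1)) := by exact_mod_cast h
  rw [h4]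
  have : e + 1 + (e + 1) = 2 * e + 2 := by ring
  rw [this]; ring

lemma w_integrable {e : ℝ} (he : -1 < e) :
    IntervalIntegrable (fun t : ℝ => (1 - t ^ 2) ^ e) MeasureTheory.volume (-1) 1 := by
  have h := (((beta_real_integrable he).comp_mul_left (c := 1 / 2)).comp_add_right 1).const_mul
    ((4 : ℝ) ^ e)
  norm_num at h
  refine h.congr_ae ?_
  rw [uIoc_of_le (by norm_num)]
  filter_upwards [MeasureTheory.ae_restrict_mem measurableSet_Ioc] with x hx
  have hx1 : 0 ≤ 1 / 2 * (x + 1) := by linarith [hx.1]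
  have hx2 : 0 ≤ 1 - 1 / 2 * (x + 1) := by linarith [hx.2]
  rw [← Real.mul_rpow hx1 hx2, ← Real.mul_rpow (by norm_num) (mul_nonneg hx1 hx2)]
  congr 1; ring

lemma wInt_one {e : ℝ} (he : -1 < e) :
    wInt e 1 = Real.Gamma (1 / 2) * Real.Gamma (e + 1) / Real.Gamma (e + 3 / 2) := by
  have h := intervalIntegral.integral_comp_mul_sub (fun t : ℝ => (1 - t ^ 2) ^ e) (a := 0) (b := 1)
    (c := 2) (by norm_num) 1
  have h2 : ∫ x in (0 : ℝ)..1, (1 - (2 * x - 1) ^ 2) ^ e =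
      4 ^ e * ∫ x in (0 : ℝ)..1, x ^ e * (1 - x) ^ e := by
    rw [← intervalIntegral.integral_const_mul]
    refine intervalIntegral.integral_congr fun x hx => ?_
    rw [uIcc_of_le zero_le_one] at hx
    have hx1 : 0 ≤ 1 - x := by linarith [hx.2]
    rw [← Real.mul_rpow hx.1 hx1, ← Real.mul_rpow (by norm_num) (mul_nonneg hx.1 hx1)]
    congr 1; ring
  rw [h2, beta_real_value he] at h
  norm_num at h
  have hd := Real.Gamma_mul_Gamma_add_half (e + 1)
  have g1 : 0 < Real.Gamma (e + 1) := Real.Gamma_pos_of_pos (by linarith)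
  have g2 : 0 < Real.Gamma (e + 3 / 2) := Real.Gamma_pos_of_pos (by linarith)
  have g3 : 0 < Real.Gamma (2 * e + 2) := Real.Gamma_pos_of_pos (by linarith)
  have e1 : e + 1 + 1 / 2 = e + 3 / 2 := by ring
  have e2 : 2 * (e + 1) = 2 * e + 2 := by ring
  rw [e1, e2] at hd
  have p1 : (2 : ℝ) ^ (1 - (2 * e + 2)) = 1 / (2 * 4 ^ e) := by
    have : (4 : ℝ) = 2 ^ (2 : ℝ) := by norm_num
    rw [this, ← Real.rpow_mul (by norm_num), show 1 - (2 * e + 2) = -(1 + 2 * e) by ring,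
      Real.rpow_neg (by norm_num), Real.rpow_add (by norm_num), Real.rpow_one, one_div]
  rw [p1] at hd
  have p2 : (0 : ℝ) < 4 ^ e := by positivity
  rw [wInt, Real.Gamma_one_half_eq]
  simp only [Polynomial.eval_one, mul_one]
  rw [eq_div_iff g2.ne']
  have h5 : (∫ t in (-1 : ℝ)..1, (1 - t ^ 2) ^ e) =
      2 * (4 ^ e * (Real.Gamma (e + 1) ^ 2 / Real.Gamma (2 * e + 2))) := by rw [h]; ring
  rw [h5]
  generalize Real.Gamma (e + 1) = G1 at *
  generalize Real.Gamma (e + 3 / 2) = G2 at *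
  generalize Real.Gamma (2 * e + 2) = G3 at *
  generalize (4 : ℝ) ^ e = F at *
  field_simp at hd ⊢
  linear_combination hd

lemma wP_integrable {e : ℝ} (he : -1 < e) (P : Polynomial ℝ) :
    IntervalIntegrable (fun t : ℝ => (1 - t ^ 2) ^ e * P.eval t) MeasureTheory.volume (-1) 1 :=
  (w_integrable he).mul_continuousOn P.continuous.continuousOn

lemma wInt_add {e : ℝ} (he : -1 < e) (P Q : Polynomial ℝ) :
    wInt e (P + Q) = wInt e P + wInt e Q := by
  simp only [wInt]
  rw [← intervalIntegral.integral_add (wP_integrable he P) (wP_integrable he Q)]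
  simp [mul_add]

lemma wInt_C {e : ℝ} (a : ℝ) (P : Polynomial ℝ) :
    wInt e (Polynomial.C a * P) = a * wInt e P := by
  simp only [wInt]
  rw [← intervalIntegral.integral_const_mul]
  congr 1; ext t; simp; ring

lemma wInt_w {e : ℝ} (P : Polynomial ℝ) :
    wInt e ((1 - Polynomial.X ^ 2) * P) = wInt (e + 1) P := by
  refine integral_congr_open fun t ht => ?_
  rw [Real.rpow_add_one (w_pos ht).ne']
  simp; ring

lemma wInt_deriv {e : ℝ} (he : -1 < e) (P : Polynomial ℝ) :
    wInt e ((1 - Polynomial.X ^ 2) * Polynomial.derivative P -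
      Polynomial.C (2 * (e + 1)) * Polynomial.X * P) = 0 := by
  have := intervalIntegral.integral_eq_sub_of_hasDerivAt_of_le (a := (-1 : ℝ)) (b := 1)
    (f := fun s : ℝ => (1 - s ^ 2) ^ (e + 1) * P.eval s)
    (f' := fun t => (1 - t ^ 2) ^ e * ((1 - Polynomial.X ^ 2) * Polynomial.derivative P -
      Polynomial.C (2 * (e + 1)) * Polynomial.X * P).eval t) (by norm_num) ?_ ?_
    (wP_integrable he _)
  · rw [wInt, this]
    have h0 : e + 1 ≠ 0 := by linarith
    simp [Real.zero_rpow h0]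
  · refine Continuous.continuousOn ?_
    refine Continuous.mul ?_ P.continuous
    exact Continuous.rpow_const (by fun_prop) (fun _ => Or.inr (by linarith))
  · intro t ht
    refine (hasDerivAt_wP (e + 1) P ht).congr_deriv ?_
    simp

lemma wInt_rec (k : ℕ) (a c : ℝ) (h : -1 < a + c - (k + 2)) :
    wInt (a + c - (k + 2)) (rodQ (k + 2) c) =
      -2 * a * ((2 * a - 1) * wInt (a - 1 + c - k) (rodQ k c)
        - 2 * (a - 1) * wInt (a - 2 + c - k) (rodQ k c)) := by
  have h1 := wInt_deriv h (rodQ (k + 1) c + Polynomial.C (2 * a) * Polynomial.X * rodQ k c)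
  have key : ((1 - Polynomial.X ^ 2) * Polynomial.derivative
        (rodQ (k + 1) c + Polynomial.C (2 * a) * Polynomial.X * rodQ k c) -
      Polynomial.C (2 * (a + c - (k + 2) + 1)) * Polynomial.X *
        (rodQ (k + 1) c + Polynomial.C (2 * a) * Polynomial.X * rodQ k c)) =
      rodQ (k + 2) c + (Polynomial.C (2 * a * (2 * a - 1)) * ((1 - Polynomial.X ^ 2) * rodQ k c)
        + Polynomial.C (- 4 * a * (a - 1)) * rodQ k c) := by
    rw [show rodQ (k + 2) c = (1 - Polynomial.X ^ 2) * Polynomial.derivative (rodQ (k + 1) c) -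
      Polynomial.C (2 * (c - (k + 1 : ℕ))) * Polynomial.X * rodQ (k + 1) c from rfl]
    have h2 : rodQ (k + 1) c = (1 - Polynomial.X ^ 2) * Polynomial.derivative (rodQ k c) -
      Polynomial.C (2 * (c - k)) * Polynomial.X * rodQ k c := rfl
    generalize hR : Polynomial.derivative (rodQ (k + 1) c) = R
    simp only [Polynomial.derivative_add, Polynomial.derivative_mul, Polynomial.derivative_C,
      Polynomial.derivative_X, hR]
    rw [h2]
    simp only [map_mul, map_sub, map_add, map_neg, map_one, map_natCast, map_ofNat]
    push_cast
    ring
  rw [key, wInt_add h, wInt_add h, wInt_C, wInt_C, wInt_w] at h1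
  rw [show a - 1 + c - k = a + c - (k + 2) + 1 by ring, show a - 2 + c - k = a + c - (k + 2) by ring]
  linear_combination h1

lemma wInt_odd (m : ℕ) : ∀ a b : ℝ, -1 < a + b →
    wInt (a + b) (rodQ (2 * m + 1) ((2 * m + 1 : ℕ) + b)) = 0 := by
  induction m with
  | zero =>
    intro a b _
    have : ∀ e c : ℝ, wInt e (rodQ 1 c) = 0 := by
      intro e c
      have h := intervalIntegral.integral_comp_neg (a := (-1 : ℝ)) (b := 1)
        (fun t : ℝ => (1 - t ^ 2) ^ e * (rodQ 1 c).eval t)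
      simp only [neg_neg] at h
      have h2 : ∫ x in (-1 : ℝ)..1, (1 - (-x) ^ 2) ^ e * (rodQ 1 c).eval (-x) = - wInt e (rodQ 1 c) := by
        rw [wInt, ← intervalIntegral.integral_neg]
        congr 1; ext x; simp [rodQ]
      rw [h2] at h
      change - wInt e (rodQ 1 c) = wInt e (rodQ 1 c) at h
      linarith
    exact this _ _
  | succ m ih =>
    intro a b h
    have h1 := wInt_rec (2 * m + 1) a ((2 * m + 1 : ℕ) + (b + 2)) (by push_cast; linarith)
    have e0 : ((2 * (m + 1) + 1 : ℕ) : ℝ) + b = ((2 * m + 1 : ℕ) + (b + 2)) := by push_cast; ring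
    rw [e0]
    rw [show a + ((2 * m + 1 : ℕ) + (b + 2)) - ((2 * m + 1 : ℕ) + 2) = a + b by push_cast; ring,
      show a - 1 + ((2 * m + 1 : ℕ) + (b + 2)) - (2 * m + 1 : ℕ) = (a - 1) + (b + 2) by push_cast; ring,
      show a - 2 + ((2 * m + 1 : ℕ) + (b + 2)) - (2 * m + 1 : ℕ) = (a - 2) + (b + 2) by push_cast; ring,
      ih (a - 1) (b + 2) (by linarith), ih (a - 2) (b + 2) (by linarith)] at h1
    rw [mul_zero, mul_zero, sub_zero, mul_zero] at h1
    exact h1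

/-- `(-1)^m` times the falling factorial, i.e. the rising factorial of `-a`. -/
noncomputable def risN (a : ℝ) (m : ℕ) : ℝ := ∏ j ∈ Finset.range m, (-a + j)

lemma risN_succ (a : ℝ) (m : ℕ) : risN a (m + 1) = risN a m * (-a + m) := Finset.prod_range_succ _ _

lemma risN_shift (a : ℝ) (m : ℕ) : risN a (m + 1) = -a * risN (a - 1) m := by
  rw [risN, Finset.prod_range_succ', mul_comm]
  congr 1
  · simp
  · refine Finset.prod_congr rfl fun j _ => ?_
    push_cast; ring

lemma wInt_even (m : ℕ) : ∀ a b : ℝ, -1 < b → -1 < a + b →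
    wInt (a + b) (rodQ (2 * m) ((2 * m : ℕ) + b)) =
      4 ^ m * Real.Gamma (m + 1 / 2) * (Real.Gamma (2 * m + b + 1) / Real.Gamma (b + 1 + m)) *
        risN a m * (Real.Gamma (a + b + 1) / Real.Gamma (a + b + 3 / 2 + m)) := by
  induction m with
  | zero =>
    intro a b hb h
    have g : Real.Gamma (b + 1) ≠ 0 := (Real.Gamma_pos_of_pos (by linarith)).ne'
    simp only [rodQ, wInt_one h, risN]
    simp [g, mul_div_assoc]
  | succ m ih =>
    intro a b hb h
    have h1 := wInt_rec (2 * m) a ((2 * m : ℕ) + (b + 2)) (by push_cast; linarith)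
    have e0 : ((2 * (m + 1) : ℕ) : ℝ) + b = ((2 * m : ℕ) + (b + 2)) := by push_cast; ring
    rw [e0]
    rw [show a + ((2 * m : ℕ) + (b + 2)) - ((2 * m : ℕ) + 2) = a + b by push_cast; ring,
      show a - 1 + ((2 * m : ℕ) + (b + 2)) - (2 * m : ℕ) = (a - 1) + (b + 2) by push_cast; ring,
      show a - 2 + ((2 * m : ℕ) + (b + 2)) - (2 * m : ℕ) = (a - 2) + (b + 2) by push_cast; ring,
      ih (a - 1) (b + 2) (by linarith) (by linarith),
      ih (a - 2) (b + 2) (by linarith) (by linarith)] at h1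
    change wInt (a + b) (rodQ (2 * m + 2) _) = _
    rw [h1]
    have hm : (0 : ℝ) ≤ m := m.cast_nonneg
    have s1 := risN_shift a m
    have s2 : (-a) * (-(a - 1) * risN (a - 2) m) = risN a (m + 1) * (-a + (m + 1 : ℕ)) := by
      rw [← risN_succ, risN_shift a, risN_shift (a - 1)]
      rw [show a - 1 - 1 = a - 2 by ring]
    have g1 : Real.Gamma ((m + 1 : ℕ) + 1 / 2) = (m + 1 / 2) * Real.Gamma (m + 1 / 2) := by
      rw [← Real.Gamma_add_one (by positivity)]; congr 1; push_cast; ring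
    have g2 : Real.Gamma (b + 2 + 1 + m) = (b + 2 + m) * Real.Gamma (b + 1 + (m + 1 : ℕ)) := by
      rw [show b + 1 + ((m + 1 : ℕ) : ℝ) = b + 2 + m by push_cast; ring,
        ← Real.Gamma_add_one (by linarith)]; congr 1; ring
    have g3 : Real.Gamma (a - 1 + (b + 2) + 1) = (a + b + 1) * Real.Gamma (a + b + 1) := by
      rw [← Real.Gamma_add_one (by linarith)]; congr 1; ring
    have g4 : Real.Gamma (a + b + 3 / 2 + (m + 1 : ℕ)) =
        (a + b + 3 / 2 + m) * Real.Gamma (a + b + 3 / 2 + m) := by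
      rw [← Real.Gamma_add_one (by linarith)]; congr 1; push_cast; ring
    have g5 : Real.Gamma (a - 1 + (b + 2) + 3 / 2 + m) =
        (a + b + 3 / 2 + m) * Real.Gamma (a + b + 3 / 2 + m) := by
      rw [← Real.Gamma_add_one (by linarith)]; congr 1; ring
    rw [g1, g2, g3, g4, g5, show a - 2 + (b + 2) + 1 = a + b + 1 by ring,
      show a - 2 + (b + 2) + 3 / 2 + (m : ℝ) = a + b + 3 / 2 + m by ring,
      show 2 * ((m + 1 : ℕ) : ℝ) + b + 1 = 2 * m + (b + 2) + 1 by push_cast; ring]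
    have p1 : Real.Gamma (b + 1 + (m + 1 : ℕ)) ≠ 0 :=
      (Real.Gamma_pos_of_pos (by push_cast; linarith)).ne'
    have p2 : Real.Gamma (a + b + 3 / 2 + m) ≠ 0 := (Real.Gamma_pos_of_pos (by linarith)).ne'
    have p3 : a + b + 3 / 2 + m ≠ 0 := by linarith
    have p4 : b + 2 + m ≠ 0 := by linarith
    generalize Real.Gamma (b + 1 + (m + 1 : ℕ)) = G1 at *
    generalize Real.Gamma (a + b + 3 / 2 + m) = G2 at *
    generalize Real.Gamma (2 * m + (b + 2) + 1) = G3 at *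
    generalize Real.Gamma (m + 1 / 2) = G4 at *
    generalize Real.Gamma (a + b + 1) = G5 at *
    push_cast at s2
    obtain ⟨S, hS⟩ : ∃ S, S = a + b + 3 / 2 + (m : ℝ) := ⟨_, rfl⟩
    rw [← hS] at p3 ⊢
    trans 4 ^ m * G4 * G3 * G5 / (G1 * G2 * (b + 2 + m) * S) *
      (2 * (2 * a - 1) * (a + b + 1) * (-a * risN (a - 1) m) +
        4 * ((-a) * (-(a - 1) * risN (a - 2) m)) * S)
    · field_simp
      ring
    · rw [← s1, s2]
      field_simp
      rw [hS]
      ring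

lemma coeff_eq (d k : ℕ) (ν : ℝ) :
    legendreCoeff d k (fun t => (1 - t ^ 2) ^ ν) = (sphereSurface (d - 1) / sphereSurface d) *
      ((-1 / 2 : ℝ) ^ k * (Real.Gamma (((d : ℝ) - 1) / 2) / Real.Gamma ((k : ℝ) + ((d : ℝ) - 1) / 2)) *
        wInt (ν + ((d : ℝ) - 3) / 2) (rodQ k (k + ((d : ℝ) - 3) / 2))) := by
  rw [legendreCoeff, wInt]
  congr 1
  rw [← intervalIntegral.integral_const_mul]
  refine integral_congr_open fun t ht => ?_
  have hw := w_pos ht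
  rw [legendreP, iteratedDeriv_w _ _ t ht,
    show (k : ℝ) + ((d : ℝ) - 3) / 2 - k = ((d : ℝ) - 3) / 2 by ring, Real.rpow_add hw,
    show (3 - (d : ℝ)) / 2 = -(((d : ℝ) - 3) / 2) by ring, Real.rpow_neg hw.le]
  have : (1 - t ^ 2) ^ (((d : ℝ) - 3) / 2) ≠ 0 := (Real.rpow_pos_of_pos hw _).ne'
  field_simp

lemma coeff_even (d : ℕ) (hd : 3 ≤ d) (ν : ℝ) (hν : 0 < ν) (m : ℕ) :
    legendreCoeff d (2 * m) (fun t => (1 - t ^ 2) ^ ν) = (sphereSurface (d - 1) / sphereSurface d) *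
      (Real.Gamma (((d : ℝ) - 1) / 2) * Real.Gamma (ν + ((d : ℝ) - 1) / 2)) *
      (Real.Gamma (m + 1 / 2) * risN ν m /
        (Real.Gamma (((d : ℝ) - 1) / 2 + m) * Real.Gamma (ν + (d : ℝ) / 2 + m))) := by
  have hd' : (3 : ℝ) ≤ d := by exact_mod_cast hd
  have hm : (0 : ℝ) ≤ m := m.cast_nonneg
  rw [coeff_eq, wInt_even m ν (((d : ℝ) - 3) / 2) (by linarith) (by linarith)]
  rw [show 2 * (m : ℝ) + ((d : ℝ) - 3) / 2 + 1 = ((2 * m : ℕ) : ℝ) + ((d : ℝ) - 1) / 2 by push_cast; ring,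
    show ((d : ℝ) - 3) / 2 + 1 + m = ((d : ℝ) - 1) / 2 + m by ring,
    show ν + ((d : ℝ) - 3) / 2 + 1 = ν + ((d : ℝ) - 1) / 2 by ring,
    show ν + ((d : ℝ) - 3) / 2 + 3 / 2 + (m : ℝ) = ν + (d : ℝ) / 2 + m by ring]
  have g1 : Real.Gamma (((2 * m : ℕ) : ℝ) + ((d : ℝ) - 1) / 2) ≠ 0 :=
    (Real.Gamma_pos_of_pos (by push_cast; linarith)).ne'
  have g2 : Real.Gamma (((d : ℝ) - 1) / 2 + m) ≠ 0 :=
    (Real.Gamma_pos_of_pos (by linarith)).ne'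
  have g3 : Real.Gamma (ν + (d : ℝ) / 2 + m) ≠ 0 :=
    (Real.Gamma_pos_of_pos (by linarith)).ne'
  have h4 : (-1 / 2 : ℝ) ^ (2 * m) * 4 ^ m = 1 := by
    rw [pow_mul, ← mul_pow]; norm_num
  generalize Real.Gamma (((2 * m : ℕ) : ℝ) + ((d : ℝ) - 1) / 2) = G1 at *
  generalize Real.Gamma (((d : ℝ) - 1) / 2 + m) = G2 at *
  generalize Real.Gamma (ν + (d : ℝ) / 2 + m) = G3 at *
  generalize Real.Gamma (ν + ((d : ℝ) - 1) / 2) = G4 at *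
  generalize Real.Gamma (((d : ℝ) - 1) / 2) = G5 at *
  generalize Real.Gamma ((m : ℝ) + 1 / 2) = G6 at *
  generalize sphereSurface (d - 1) / sphereSurface d = c
  trans ((-1 / 2 : ℝ) ^ (2 * m) * 4 ^ m) * (c * (G5 * G4) * (G6 * risN ν m / (G2 * G3)))
  · field_simp
  · rw [h4, one_mul]

lemma Gamma_half_refl (m : ℕ) :
    Real.Gamma (m + 1 / 2) * Real.Gamma (1 / 2 - m) = (-1) ^ m * π := by
  have h := Real.Gamma_mul_Gamma_one_sub (m + 1 / 2)
  rw [show 1 - ((m : ℝ) + 1 / 2) = 1 / 2 - m by ring,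
    show π * ((m : ℝ) + 1 / 2) = m * π + π / 2 by ring, Real.sin_add_pi_div_two,
    Real.cos_nat_mul_pi] at h
  rw [h]
  rcases neg_one_pow_eq_or ℝ m with h | h <;> rw [h] <;> ring

lemma Gamma_fall (ν : ℝ) (h : ∀ n : ℤ, ν ≠ (n : ℝ)) (m : ℕ) :
    Real.Gamma (ν + 1) = (-1) ^ m * risN ν m * Real.Gamma (ν + 1 - m) := by
  induction m with
  | zero => simp [risN]
  | succ m ih =>
    have h0 : ν - m ≠ 0 := sub_ne_zero.2 (by exact_mod_cast h m)
    have h1 := Real.Gamma_add_one h0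
    rw [show ν - m + 1 = ν + 1 - m by ring] at h1
    rw [ih, h1, risN_succ, show ν + 1 - ((m + 1 : ℕ) : ℝ) = ν - m by push_cast; ring, pow_succ]
    ring

lemma coeff_even_formula (d : ℕ) (hd : 3 ≤ d) (ν : ℝ) (hν : 0 < ν)
    (hνnonint : ∀ n : ℤ, ν ≠ (n : ℝ)) (k : ℕ) (hk : Even k) :
      legendreCoeff d k (fun t => (1 - t ^ 2) ^ ν) =
        (sphereSurface (d - 1) / sphereSurface d) * (2 : ℝ) ^ (2 * ν + (d : ℝ) - 2) *
          (Real.Gamma (ν + ((d : ℝ) - 1) / 2) ^ 2 / Real.Gamma (2 * ν + (d : ℝ) - 1)) *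
          (Real.Gamma (1 / 2) * Real.Gamma (ν + (d : ℝ) / 2) * Real.Gamma (((d : ℝ) - 1) / 2) *
            Real.Gamma (ν + 1)) /
          (Real.Gamma ((1 - (k : ℝ)) / 2) * Real.Gamma (((d : ℝ) + (k : ℝ) - 1) / 2) *
            Real.Gamma (ν + (k : ℝ) / 2 + (d : ℝ) / 2) * Real.Gamma (ν + 1 - (k : ℝ) / 2)) := by
  obtain ⟨m, rfl⟩ := hk.exists_two_nsmul
  rw [smul_eq_mul]
  have hd' : (3 : ℝ) ≤ d := by exact_mod_cast hd
  have hm : (0 : ℝ) ≤ m := m.cast_nonneg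
  rw [coeff_even d hd ν hν m]
  push_cast
  rw [show (1 - 2 * (m : ℝ)) / 2 = 1 / 2 - m by ring,
    show ((d : ℝ) + 2 * m - 1) / 2 = ((d : ℝ) - 1) / 2 + m by ring,
    show ν + 2 * (m : ℝ) / 2 + (d : ℝ) / 2 = ν + (d : ℝ) / 2 + m by ring,
    show ν + 1 - 2 * (m : ℝ) / 2 = ν + 1 - m by ring]
  have r1 := Gamma_half_refl m
  have r2 := Gamma_fall ν hνnonint m
  have r3 := Real.Gamma_mul_Gamma_add_half (ν + ((d : ℝ) - 1) / 2)
  rw [show ν + ((d : ℝ) - 1) / 2 + 1 / 2 = ν + (d : ℝ) / 2 by ring,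
    show 2 * (ν + ((d : ℝ) - 1) / 2) = 2 * ν + d - 1 by ring,
    show 1 - (2 * ν + (d : ℝ) - 1) = -(2 * ν + d - 2) by ring, Real.rpow_neg (by norm_num)] at r3
  have hG : 0 < Real.Gamma (ν + 1) := Real.Gamma_pos_of_pos (by linarith)
  have q1 : Real.Gamma (ν + 1 - m) ≠ 0 := by
    intro h0; rw [h0, mul_zero] at r2; exact hG.ne' r2
  have q2 : Real.Gamma (1 / 2 - m) ≠ 0 := by
    intro h0; rw [h0, mul_zero] at r1
    have : ((-1 : ℝ)) ^ m * π ≠ 0 := mul_ne_zero (pow_ne_zero _ (by norm_num)) Real.pi_ne_zero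
    exact this r1.symm
  have g2 : Real.Gamma (((d : ℝ) - 1) / 2 + m) ≠ 0 :=
    (Real.Gamma_pos_of_pos (by linarith)).ne'
  have g3 : Real.Gamma (ν + (d : ℝ) / 2 + m) ≠ 0 :=
    (Real.Gamma_pos_of_pos (by linarith)).ne'
  have g4 : Real.Gamma (2 * ν + d - 1) ≠ 0 :=
    (Real.Gamma_pos_of_pos (by linarith)).ne'
  have p2 : (2 : ℝ) ^ (2 * ν + (d : ℝ) - 2) ≠ 0 := by positivity
  have hpi : √π * √π = π := Real.mul_self_sqrt Real.pi_pos.le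
  have hs : ((-1 : ℝ)) ^ m * (-1) ^ m = 1 := by rw [← mul_pow]; norm_num
  rw [r2, Real.Gamma_one_half_eq]
  generalize Real.Gamma (((d : ℝ) - 1) / 2 + m) = G2 at *
  generalize Real.Gamma (ν + (d : ℝ) / 2 + m) = G3 at *
  generalize Real.Gamma (2 * ν + d - 1) = G8 at *
  generalize Real.Gamma (ν + (d : ℝ) / 2) = G7 at *
  generalize Real.Gamma (ν + ((d : ℝ) - 1) / 2) = G4 at *
  generalize Real.Gamma (((d : ℝ) - 1) / 2) = G5 at *
  generalize Real.Gamma ((m : ℝ) + 1 / 2) = G6 at *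
  generalize Real.Gamma (1 / 2 - (m : ℝ)) = G9 at *
  generalize Real.Gamma (ν + 1 - (m : ℝ)) = G10 at *
  generalize (2 : ℝ) ^ (2 * ν + (d : ℝ) - 2) = T at *
  generalize sphereSurface (d - 1) / sphereSurface d = c
  generalize risN ν m = R at *
  generalize ((-1 : ℝ)) ^ m = s at *
  have r4 : T * G4 * G7 = G8 * √π := by
    field_simp at r3; linear_combination r3
  have r5 : G6 = s * π / G9 := by field_simp; exact r1
  trans c * G4 * G5 * (s * R) * √π * (T * G4 * G7) / (G8 * G2 * G3 * G9)
  · rw [r4, r5]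
    field_simp
    rw [sq, hpi]
    ring
  · field_simp

lemma tendsto_Gamma_ratio (x : ℝ) (hx : 0 < x) :
    Tendsto (fun n : ℕ => Real.Gamma (x + (n + 1 : ℕ)) / ((n : ℝ) ^ x * (n.factorial : ℝ)))
      atTop (𝓝 1) := by
  have hG := (Real.Gamma_pos_of_pos hx).ne'
  have h := ((Real.GammaSeq_tendsto_Gamma x).inv₀ hG).const_mul (Real.Gamma x)
  rw [mul_inv_cancel₀ hG] at h
  refine h.congr fun n => ?_
  have : ∀ n : ℕ, Real.Gamma (x + n) = Real.Gamma x * ∏ j ∈ Finset.range n, (x + j) := by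
    intro n
    induction n with
    | zero => simp
    | succ n ih =>
      rw [Finset.prod_range_succ, ← mul_assoc, ← ih, Nat.cast_succ, ← add_assoc,
        Real.Gamma_add_one (by positivity)]
      ring
  rw [this, Real.GammaSeq, inv_div, mul_div_assoc]

lemma tendsto_risN_ratio (ν : ℝ) (hν : ∀ n : ℤ, ν ≠ (n : ℝ)) :
    Tendsto (fun n : ℕ => risN ν (n + 1) / ((n : ℝ) ^ (-ν) * (n.factorial : ℝ)))
      atTop (𝓝 (Real.Gamma (-ν))⁻¹) := by
  have hG : Real.Gamma (-ν) ≠ 0 := Real.Gamma_ne_zero fun m h => hν m (by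
    push_cast; linarith)
  refine ((Real.GammaSeq_tendsto_Gamma (-ν)).inv₀ hG).congr fun n => ?_
  rw [Real.GammaSeq, inv_div, risN]

lemma coeff_tendsto (d : ℕ) (hd : 3 ≤ d) (ν : ℝ) (hν : 0 < ν)
    (hνnonint : ∀ n : ℤ, ν ≠ (n : ℝ)) :
    ∃ C : ℝ, C ≠ 0 ∧
      Tendsto (fun n : ℕ =>
          legendreCoeff d (2 * (n + 1)) (fun t => (1 - t ^ 2) ^ ν) *
            ((2 * (n + 1) : ℕ) : ℝ) ^ ((d : ℝ) + 2 * ν - 1)) atTop (𝓝 C) := by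
  have hd' : (3 : ℝ) ≤ d := by exact_mod_cast hd
  have hG : Real.Gamma (-ν) ≠ 0 := Real.Gamma_ne_zero fun m h => hνnonint m (by
    push_cast; linarith)
  set K : ℝ := (sphereSurface (d - 1) / sphereSurface d) *
      (Real.Gamma (((d : ℝ) - 1) / 2) * Real.Gamma (ν + ((d : ℝ) - 1) / 2)) with hK
  have hss : ∀ p : ℕ, 0 < p → sphereSurface p ≠ 0 := by
    intro p hp
    have : (0 : ℝ) < p := by exact_mod_cast hp
    have := Real.Gamma_pos_of_pos (show (0 : ℝ) < (p : ℝ) / 2 by positivity)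
    have := Real.pi_pos
    rw [sphereSurface]; positivity
  have hK0 : K ≠ 0 := by
    refine mul_ne_zero (div_ne_zero (hss _ (by omega)) (hss _ (by omega))) (mul_ne_zero ?_ ?_)
    · exact (Real.Gamma_pos_of_pos (by linarith)).ne'
    · exact (Real.Gamma_pos_of_pos (by linarith)).ne'
  have t1 := tendsto_Gamma_ratio (1 / 2) (by norm_num)
  have t2 := tendsto_risN_ratio ν hνnonint
  have t3 := tendsto_Gamma_ratio (((d : ℝ) - 1) / 2) (by linarith)
  have t4 := tendsto_Gamma_ratio (ν + (d : ℝ) / 2) (by linarith)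
  have t5 : Tendsto (fun n : ℕ => (2 + 2 / (n : ℝ)) ^ ((d : ℝ) + 2 * ν - 1)) atTop
      (𝓝 ((2 : ℝ) ^ ((d : ℝ) + 2 * ν - 1))) := by
    have := (tendsto_const_div_atTop_nhds_zero_nat (2 : ℝ)).const_add 2
    rw [add_zero] at this
    exact this.rpow_const (Or.inl (by norm_num))
  have t := (((t1.mul t2).div (t3.mul t4) (by norm_num)).mul t5).const_mul K
  refine ⟨_, ?_, t.congr' ?_⟩
  · have : (2 : ℝ) ^ ((d : ℝ) + 2 * ν - 1) ≠ 0 := by positivity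
    simp [hK0, hG, this]
  · filter_upwards [eventually_gt_atTop 0] with n hn
    have hn' : (0 : ℝ) < n := by exact_mod_cast hn
    rw [coeff_even d hd ν hν (n + 1), ← hK]
    simp only [Pi.div_apply]
    rw [show (((2 * (n + 1) : ℕ)) : ℝ) = (2 + 2 / (n : ℝ)) * n by push_cast; field_simp,
      Real.mul_rpow (by positivity) hn'.le,
      show (d : ℝ) + 2 * ν - 1 = (((d : ℝ) - 1) / 2) + (ν + (d : ℝ) / 2) - (1 / 2 + (-ν)) by ring]
    rw [Real.rpow_sub hn' (_ + _) (_ + _), Real.rpow_add hn' (1 / 2), Real.rpow_add hn' (((d : ℝ) - 1) / 2),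
      add_comm (((n + 1 : ℕ)) : ℝ) (1 / 2)]
    have f0 : (n.factorial : ℝ) ≠ 0 := by positivity
    have a1 : (n : ℝ) ^ (1 / 2 : ℝ) ≠ 0 := (Real.rpow_pos_of_pos hn' _).ne'
    have a2 : (n : ℝ) ^ (-ν) ≠ 0 := (Real.rpow_pos_of_pos hn' _).ne'
    have a3 : (n : ℝ) ^ (((d : ℝ) - 1) / 2) ≠ 0 := (Real.rpow_pos_of_pos hn' _).ne'
    have a4 : (n : ℝ) ^ (ν + (d : ℝ) / 2) ≠ 0 := (Real.rpow_pos_of_pos hn' _).ne'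
    have b3 : Real.Gamma (((d : ℝ) - 1) / 2 + (n + 1 : ℕ)) ≠ 0 :=
      (Real.Gamma_pos_of_pos (add_pos (by linarith) (by positivity))).ne'
    have b4 : Real.Gamma (ν + (d : ℝ) / 2 + (n + 1 : ℕ)) ≠ 0 :=
      (Real.Gamma_pos_of_pos (by positivity)).ne'
    generalize Real.Gamma (((d : ℝ) - 1) / 2 + (n + 1 : ℕ)) = G1 at *
    generalize Real.Gamma (ν + (d : ℝ) / 2 + (n + 1 : ℕ)) = G2 at *
    generalize Real.Gamma (1 / 2 + ((n + 1 : ℕ) : ℝ)) = G3 at *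
    generalize (n : ℝ) ^ (1 / 2 : ℝ) = A1 at *
    generalize (n : ℝ) ^ (-ν) = A2 at *
    generalize (n : ℝ) ^ (((d : ℝ) - 1) / 2) = A3 at *
    generalize (n : ℝ) ^ (ν + (d : ℝ) / 2) = A4 at *
    generalize (2 + 2 / (n : ℝ)) ^ (_ : ℝ) = B at *
    field_simp

/-- Legendre coefficients of `φ_ν(t) = (1-t²)^ν`: vanishing for odd `k`, closed form for even
`k`, and precise asymptotic decay `k^{-d-2ν+1}` along even `k`. -/
theorem phi_nu_decay (d : ℕ) (hd : 3 ≤ d) (ν : ℝ) (hν : 0 < ν)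
    (hνnonint : ∀ n : ℤ, ν ≠ (n : ℝ)) :
    (∀ k : ℕ, Odd k → legendreCoeff d k (fun t => (1 - t ^ 2) ^ ν) = 0) ∧
    (∀ k : ℕ, Even k →
      legendreCoeff d k (fun t => (1 - t ^ 2) ^ ν) =
        (sphereSurface (d - 1) / sphereSurface d) * (2 : ℝ) ^ (2 * ν + (d : ℝ) - 2) *
          (Real.Gamma (ν + ((d : ℝ) - 1) / 2) ^ 2 / Real.Gamma (2 * ν + (d : ℝ) - 1)) *
          (Real.Gamma (1 / 2) * Real.Gamma (ν + (d : ℝ) / 2) * Real.Gamma (((d : ℝ) - 1) / 2) *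
            Real.Gamma (ν + 1)) /
          (Real.Gamma ((1 - (k : ℝ)) / 2) * Real.Gamma (((d : ℝ) + (k : ℝ) - 1) / 2) *
            Real.Gamma (ν + (k : ℝ) / 2 + (d : ℝ) / 2) * Real.Gamma (ν + 1 - (k : ℝ) / 2))) ∧
    (∃ C : ℝ, C ≠ 0 ∧
      Tendsto (fun k : ℕ =>
          legendreCoeff d k (fun t => (1 - t ^ 2) ^ ν) * (k : ℝ) ^ ((d : ℝ) + 2 * ν - 1))
        (atTop ⊓ 𝓟 {k | Even k}) (𝓝 C)) := by
  refine ⟨?_, fun k hk => coeff_even_formula d hd ν hν hνnonint k hk, ?_⟩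
  · rintro k ⟨m, rfl⟩
    have hd' : (3 : ℝ) ≤ d := by exact_mod_cast hd
    rw [coeff_eq, wInt_odd m ν (((d : ℝ) - 3) / 2) (by linarith)]
    simp
  · obtain ⟨C, hC, h⟩ := coeff_tendsto d hd ν hν hνnonint
    refine ⟨C, hC, ?_⟩
    have h1 : Tendsto (fun k : ℕ => k / 2 - 1) (atTop ⊓ 𝓟 {k | Even k}) atTop := by
      refine Tendsto.mono_left ?_ inf_le_left
      refine tendsto_atTop.2 fun b => ?_
      filter_upwards [eventually_ge_atTop (2 * b + 2)] with k hk
      omega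
    refine (h.comp h1).congr' ?_
    refine eventually_inf_principal.2 ?_
    filter_upwards [eventually_ge_atTop 2] with k hk hke
    obtain ⟨m, rfl⟩ := hke.exists_two_nsmul
    have : 2 * (2 • m / 2 - 1 + 1) = 2 • m := by simp only [smul_eq_mul] at *; omega
    simp only [Function.comp, this]
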